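/- With C = 2^{1/3}π²/(3·Γ(1/3)³) and φ(z) = 2^{−8/3}·λ(z)^{2/3}·₂F₁(1/3,2/3;5/3;λ(z)), one has φ(i) = C/2; equivalently, 2^{−8/3}·(1/2)^{2/3}·₂F₁(1/3,2/3;5/3;1/2) = 2^{1/3}π²/(6·Γ(1/3)³), using λ(i) = 1/2. -/

import Mathlib

open Complex

/-- The Dedekind eta function `η(z) = q^{1/24} ∏_{n ≥ 1} (1 - qⁿ)` with `q = e^{2πiz}`. -/
noncomputable def dedekindEta (z : ℂ) : ℂ :=
  Complex.exp (Real.pi * I * z / 12) *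
    ∏' n : ℕ, (1 - Complex.exp (2 * Real.pi * I * (n + 1) * z))

/-- The modular lambda function `λ(z) = 16 η(z/2)^8 η(2z)^16 / η(z)^24`. -/
noncomputable def modularLambda (z : ℂ) : ℂ :=
  16 * dedekindEta (z / 2) ^ 8 * dedekindEta (2 * z) ^ 16 / dedekindEta z ^ 24

/-- The Gauss hypergeometric function `₂F₁(a, b; c; x)`, as a power series. -/
noncomputable def hyperGeom (a b c x : ℂ) : ℂ :=
  ∑' n : ℕ,
    (Polynomial.eval a (ascPochhammer ℂ n) * Polynomial.eval b (ascPochhammer ℂ n) /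
      (Polynomial.eval c (ascPochhammer ℂ n) * (n.factorial : ℂ))) * x ^ n

section
open Complex
/-- The Euler product. -/
noncomputable def eulerP (q : ℂ) : ℂ := ∏' n : ℕ, (1 - q ^ (n + 1))

noncomputable def discC (z : ℂ) : ℂ := ModularForm.eta z ^ 24

lemma discC_eq (z : ℂ) : discC z = cexp (2 * Real.pi * I * z) * eulerP (cexp (2 * Real.pi * I * z)) ^ 24 := by
  unfold discC ModularForm.eta eulerP
  simp only [ModularForm.eta_q_eq_pow, mul_pow]
  congr 1
  rw [Function.Periodic.qParam, ← Complex.exp_nat_mul]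
  congr 1
  push_cast
  ring

lemma discC_ne_zero {z : ℂ} (hz : 0 < z.im) : discC z ≠ 0 :=
  pow_ne_zero _ (ModularForm.eta_ne_zero hz)

lemma discC_add_one (z : ℂ) : discC (z + 1) = discC z := by
  have : cexp (2 * Real.pi * I * (z + 1)) = cexp (2 * Real.pi * I * z) := by
    rw [mul_add, mul_one, Complex.exp_add, Complex.exp_two_pi_mul_I, mul_one]
  rw [discC_eq, discC_eq, this]

lemma eta_inv {z : ℂ} (hz : 0 < z.im) :
    ModularForm.eta (-1 / z) = (Complex.sqrt I)⁻¹ * (Complex.sqrt z * ModularForm.eta z) :=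
  ModularForm.eta_comp_eq_csqrt_I_inv hz

lemma csqrt_sq (z : ℂ) : Complex.sqrt z ^ 2 = z := by
  rcases eq_or_ne z 0 with rfl | hz
  · simp [Complex.sqrt]
  · rw [sqrt_eq_exp hz, ← Complex.exp_nat_mul]
    rw [show ((2 : ℕ) : ℂ) * (Complex.log z / 2) = Complex.log z by push_cast; ring, Complex.exp_log hz]

lemma eta_inv_pow8 {z : ℂ} (hz : 0 < z.im) :
    ModularForm.eta (-1 / z) ^ 8 = z ^ 4 * ModularForm.eta z ^ 8 := by
  rw [eta_inv hz, mul_pow, mul_pow, inv_pow]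
  have h1 : Complex.sqrt I ^ 8 = 1 := by
    rw [show 8 = 2 * 4 from rfl, pow_mul, csqrt_sq, I_pow_four]
  have h2 : Complex.sqrt z ^ 8 = z ^ 4 := by
    rw [show 8 = 2 * 4 from rfl, pow_mul, csqrt_sq]
  rw [h1, h2]; ring

lemma discC_inv {z : ℂ} (hz : 0 < z.im) : discC (-1 / z) = z ^ 12 * discC z := by
  have := congrArg (· ^ 3) (eta_inv_pow8 hz)
  unfold discC
  ring_nf at this ⊢
  exact this

lemma im_inv_pos {z : ℂ} (hz : 0 < z.im) : 0 < (-1 / z).im := by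
  have h0 : z ≠ 0 := by rintro rfl; simp at hz
  have : 0 < Complex.normSq z := Complex.normSq_pos.mpr h0
  rw [neg_div, one_div, neg_im, inv_im]
  rw [neg_div, neg_neg]
  positivity

lemma discC_third {z : ℂ} (hz : 0 < z.im) :
    discC ((-1 / z + 1) / 2) = z ^ 12 * discC ((z + 1) / 2) := by
  have h0 : z ≠ 0 := by rintro rfl; simp at hz
  have h1 : z - 1 ≠ 0 := by
    intro h
    have : z = 1 := by linear_combination h
    rw [this] at hz; simp at hz
  have hv : 0 < ((-1 / z + 1) / 2).im := by
    have := im_inv_pos hz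
    have e : ((-1 / z + 1) / 2).im = (-1 / z).im / 2 := by
      rw [show (-1 / z + 1) / 2 = ((1 / 2 : ℝ) : ℂ) * (-1 / z + 1) by push_cast; ring, Complex.im_ofReal_mul]
      simp only [add_im, one_im]; ring
    rw [e]; positivity
  have hu : 0 < ((z - 1) / 2).im := by
    have e : ((z - 1) / 2).im = z.im / 2 := by
      rw [show (z - 1) / 2 = ((1 / 2 : ℝ) : ℂ) * (z - 1) by push_cast; ring, Complex.im_ofReal_mul]
      simp only [sub_im, one_im]; ring
    rw [e]; positivity
  have e1 := discC_inv hv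
  have e2 := discC_inv hu
  have e3 : -1 / ((z - 1) / 2) = -1 / ((-1 / z + 1) / 2) + 1 + 1 := by
    have : -1 + z ≠ 0 := by intro h; apply h1; linear_combination h
    field_simp
    rw [show -1 + z = z - 1 by ring]
    field_simp
    ring
  rw [e3, discC_add_one, discC_add_one, e1] at e2
  have e4 : discC ((z + 1) / 2) = discC ((z - 1) / 2) := by
    rw [← discC_add_one ((z - 1) / 2)]; congr 1; ring
  rw [e4]
  have e5 : (-1 / z + 1) / 2 = ((z - 1) / 2) / z := by field_simp; ring
  rw [e5] at e2 ⊢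
  generalize discC ((z - 1) / 2 / z) = A at *
  rw [div_pow] at e2
  field_simp at e2
  exact e2

/-- product identity -/
lemma eulerP_prod {w : ℂ} (hw : ‖w‖ < 1) :
    eulerP w * eulerP (-w) * eulerP (w ^ 4) = eulerP (w ^ 2) ^ 3 := by
  have key : ∀ q : ℂ, ‖q‖ < 1 → eulerP q = (∏' n : ℕ, (1 - q ^ (2 * n + 1))) * eulerP (q ^ 2) ∧
      Multipliable (fun n : ℕ => (1 - q ^ (2 * n + 1))) := by
    intro q hq
    have ho : Multipliable (fun n : ℕ => (1 - q ^ (2 * n + 1))) := by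
      have : (fun n : ℕ => (1 - q ^ (2 * n + 1))) = fun n => 1 + (-q ^ (2 * n + 1)) := by
        ext n; ring
      rw [this]
      apply multipliable_one_add_of_summable
      have hs := (summable_geometric_of_lt_one (norm_nonneg _) hq)
      have := hs.comp_injective (i := fun n : ℕ => 2 * n + 1) (fun a b h => by simpa using h)
      simpa [Function.comp_def] using this
    refine ⟨?_, ho⟩
    have he : Multipliable (fun n : ℕ => (1 - (q ^ 2) ^ (n + 1))) :=
      ModularForm.multipliable_one_sub_pow (by rw [norm_pow]; exact pow_lt_one₀ (norm_nonneg _) hq two_ne_zero)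
    have := tprod_even_mul_odd (f := fun n : ℕ => 1 - q ^ (n + 1)) ho (by
      convert he using 2 with n; ring_nf)
    unfold eulerP
    rw [← this]
    congr 2
    ext n; ring_nf
  have n2 : ‖w ^ 2‖ < 1 := by rw [norm_pow]; exact pow_lt_one₀ (norm_nonneg _) hw two_ne_zero
  obtain ⟨a1, m1⟩ := key w hw
  obtain ⟨a2, m2⟩ := key (-w) (by simpa using hw)
  obtain ⟨a3, m3⟩ := key (w ^ 2) n2
  have hp := m1.tprod_mul m2
  have : (fun n : ℕ => (1 - w ^ (2 * n + 1)) * (1 - (-w) ^ (2 * n + 1))) = fun n => 1 - (w ^ 2) ^ (2 * n + 1) := by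
    ext n
    rw [Odd.neg_pow ⟨n, rfl⟩]; ring
  rw [this] at hp
  rw [a1, a2, show (-w) ^ 2 = w ^ 2 by ring]
  rw [← pow_mul] at a3
  norm_num at a3
  linear_combination (-eulerP (w^2)^2 * eulerP (w^4)) * hp - eulerP (w^2)^2 * a3

lemma norm_R_le {w : ℂ} (hw : ‖w‖ ≤ 1 / 2) :
    ‖(∏' n : ℕ, (1 - w ^ (n + 2))) - 1‖ ≤ 4 * ‖w‖ ^ 2 := by
  have hs : HasSum (fun n : ℕ => ‖w‖ ^ (n + 2)) (‖w‖ ^ 2 * (1 - ‖w‖)⁻¹) := by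
    have := (hasSum_geometric_of_lt_one (norm_nonneg w) (by linarith)).mul_left (‖w‖ ^ 2)
    simpa only [pow_add, mul_comm] using this
  have hb : ‖w‖ ^ 2 * (1 - ‖w‖)⁻¹ ≤ 2 * ‖w‖ ^ 2 := by
    have : (1 - ‖w‖)⁻¹ ≤ 2 := by
      rw [inv_le_comm₀ (by linarith) (by norm_num)]; linarith
    nlinarith [sq_nonneg ‖w‖]
  have hm : Multipliable (fun n : ℕ => (1 + (-w ^ (n + 2)))) := by
    apply multipliable_one_add_of_summable
    simpa using hs.summable
  have h := hm.hasProd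
  have e : (fun n : ℕ => (1 - w ^ (n + 2))) = (fun n : ℕ => (1 + (-w ^ (n + 2)))) := by
    ext n; ring
  rw [e]
  refine le_of_tendsto ((h.sub_const 1).norm) (Filter.Eventually.of_forall fun t => ?_)
  refine (Finset.norm_prod_one_add_sub_one_le t _).trans ?_
  have hsum : ∑ i ∈ t, ‖-w ^ (i + 2)‖ ≤ 2 * ‖w‖ ^ 2 := by
    simp only [norm_neg, norm_pow]
    exact (sum_le_hasSum t (fun _ _ => by positivity) hs).trans hb
  have h1 : 2 * ‖w‖ ^ 2 ≤ 1 := by nlinarith [norm_nonneg w]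
  have h0 : 0 ≤ ∑ i ∈ t, ‖-w ^ (i + 2)‖ := by positivity
  have := Real.abs_exp_sub_one_le (x := ∑ i ∈ t, ‖-w ^ (i + 2)‖) (by rw [abs_of_nonneg h0]; linarith)
  rw [abs_of_nonneg h0] at this
  have := (le_abs_self _).trans this
  linarith

lemma eulerP_zero : eulerP 0 = 1 := by simp [eulerP]

lemma eulerP_factor {w : ℂ} (hw' : ‖w‖ < 1) :
    eulerP w = (1 - w) * ∏' n : ℕ, (1 - w ^ (n + 2)) := by
  unfold eulerP
  have hm := ModularForm.multipliable_one_sub_pow hw'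
  have hm2 : Multipliable (fun n : ℕ => 1 - w ^ (n + 1 + 1)) := by
    have : (fun n : ℕ => (1 - w ^ (n + 1 + 1))) = fun n => 1 + (-w ^ (n + 1 + 1)) := by
      ext n; ring
    rw [this]
    apply multipliable_one_add_of_summable
    have hs := (summable_geometric_of_lt_one (norm_nonneg _) hw')
    have := hs.comp_injective (i := fun n : ℕ => n + 1 + 1) (fun a b h => by simpa using h)
    simpa [Function.comp_def] using this
  have := tprod_eq_zero_mul' (f := fun n : ℕ => 1 - w ^ (n + 1)) hm2
  simpa only [zero_add, pow_one] using this

lemma hasDerivAt_eulerP : HasDerivAt eulerP (-1) 0 := by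
  have hR : HasDerivAt (fun w : ℂ => ∏' n : ℕ, (1 - w ^ (n + 2))) 0 0 := by
    rw [hasDerivAt_iff_isLittleO]
    have : (fun x' : ℂ => (∏' n : ℕ, (1 - x' ^ (n + 2))) - (∏' n : ℕ, (1 - (0:ℂ) ^ (n + 2))) - (x' - 0) • (0:ℂ))
      =O[nhds 0] fun w : ℂ => w ^ 2 := by
      apply Asymptotics.IsBigO.of_bound 4
      filter_upwards [Metric.closedBall_mem_nhds (0:ℂ) (by norm_num : (0:ℝ) < 1/2)] with w hw
      have := norm_R_le (w := w) (by simpa using hw)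
      simpa using this
    refine this.trans_isLittleO ?_
    simpa using Asymptotics.isLittleO_pow_id (𝕜 := ℂ) (n := 2) (by norm_num)
  have h2 : HasDerivAt (fun w : ℂ => (1 - w) * ∏' n : ℕ, (1 - w ^ (n + 2))) (-1) 0 := by
    have := ((hasDerivAt_id (0:ℂ)).const_sub 1).mul hR
    simpa using! this
  refine h2.congr_of_eventuallyEq ?_
  filter_upwards [Metric.ball_mem_nhds (0:ℂ) one_pos] with w hw
  have hw' : ‖w‖ < 1 := by simpa using hw
  exact eulerP_factor hw'

end

section
open Complex
open Filter Topology ModularForm MatrixGroups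
open UpperHalfPlane hiding I I_re I_im

noncomputable def heckeNum (z : ℂ) : ℂ :=
  (4096 * discC (2 * z) + discC (z / 2) + discC ((z + 1) / 2)) / discC z

lemma im_half {z : ℂ} (hz : 0 < z.im) : 0 < (z / 2).im := by
  rw [show z / 2 = ((1 / 2 : ℝ) : ℂ) * z by push_cast; ring, Complex.im_ofReal_mul]
  positivity

lemma im_double {z : ℂ} (hz : 0 < z.im) : 0 < (2 * z).im := by
  rw [show 2 * z = ((2 : ℝ) : ℂ) * z by push_cast; ring, Complex.im_ofReal_mul]
  positivity

lemma heckeNum_add_one (z : ℂ) : heckeNum (z + 1) = heckeNum z := by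
  unfold heckeNum
  rw [show 2 * (z + 1) = 2 * z + 1 + 1 by ring, discC_add_one, discC_add_one,
    show (z + 1 + 1) / 2 = z / 2 + 1 by ring, discC_add_one, discC_add_one]
  ring

lemma heckeNum_inv {z : ℂ} (hz : 0 < z.im) : heckeNum (-1 / z) = heckeNum z := by
  have h0 : z ≠ 0 := by rintro rfl; simp at hz
  unfold heckeNum
  rw [discC_third hz, discC_inv hz, show 2 * (-1 / z) = -1 / (z / 2) by field_simp,
    discC_inv (im_half hz), show -1 / z / 2 = -1 / (2 * z) by field_simp, discC_inv (im_double hz)]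
  have := discC_ne_zero hz
  field_simp
  ring

lemma heckeNum_eq (z : ℂ) (w : ℂ) (hw : w = cexp (Real.pi * I * z)) : heckeNum z =
    ((eulerP w ^ 24 - eulerP (-w) ^ 24) / w + 4096 * w ^ 2 * eulerP (w ^ 4) ^ 24) /
      eulerP (w ^ 2) ^ 24 := by
  have hw0 : w ≠ 0 := by rw [hw]; exact Complex.exp_ne_zero _
  unfold heckeNum
  simp only [discC_eq]
  have e1 : cexp (2 * Real.pi * I * (2 * z)) = w ^ 4 := by
    rw [hw, ← Complex.exp_nat_mul]; congr 1; push_cast; ring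
  have e2 : cexp (2 * Real.pi * I * (z / 2)) = w := by
    rw [hw]; congr 1; ring
  have e3 : cexp (2 * Real.pi * I * ((z + 1) / 2)) = -w := by
    rw [hw, show 2 * Real.pi * I * ((z + 1) / 2) = Real.pi * I * z + Real.pi * I by ring,
      Complex.exp_add, Complex.exp_pi_mul_I]; ring
  have e4 : cexp (2 * Real.pi * I * z) = w ^ 2 := by
    rw [hw, ← Complex.exp_nat_mul]; congr 1; push_cast; ring
  rw [e1, e2, e3, e4]
  rcases eq_or_ne (eulerP (w ^ 2)) 0 with h | h
  · simp [h]
  field_simp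
  ring

lemma tendsto_aux : Tendsto (fun w : ℂ =>
    ((eulerP w ^ 24 - eulerP (-w) ^ 24) / w + 4096 * w ^ 2 * eulerP (w ^ 4) ^ 24) /
      eulerP (w ^ 2) ^ 24) (𝓝[≠] 0) (𝓝 (-48)) := by
  have hd := hasDerivAt_eulerP
  have hc : ContinuousAt eulerP 0 := hd.continuousAt
  have hn : HasDerivAt (fun w => eulerP (-w)) 1 0 := by
    have := HasDerivAt.comp (0:ℂ) (h₂ := eulerP) (h := fun w => -w) (h₂' := -1) (by simpa using hd) (hasDerivAt_neg 0)
    simpa [Function.comp_def] using this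
  have h1 : HasDerivAt (fun w => eulerP w ^ 24 - eulerP (-w) ^ 24) (-48) 0 := by
    have := (hd.fun_pow 24).fun_sub (hn.fun_pow 24)
    rw [neg_zero, eulerP_zero] at this
    have e : ((24 : ℕ) : ℂ) * 1 ^ (24 - 1) * -1 - ((24 : ℕ) : ℂ) * 1 ^ (24 - 1) * 1 = -48 := by
      norm_num
    rw [e] at this
    exact this
  have h2 := hasDerivAt_iff_tendsto_slope.mp h1
  have h3 : Tendsto (fun w => (eulerP w ^ 24 - eulerP (-w) ^ 24) / w) (𝓝[≠] 0) (𝓝 (-48)) := by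
    refine h2.congr fun w => ?_
    simp [slope_def_field, eulerP_zero]
  have hk : ∀ k : ℕ, k ≠ 0 → Tendsto (fun w : ℂ => eulerP (w ^ k)) (𝓝[≠] 0) (𝓝 1) := by
    intro k hk
    have : Tendsto (fun w : ℂ => w ^ k) (𝓝[≠] 0) (𝓝 0) := by
      have := (continuous_pow k (M := ℂ)).tendsto 0
      rw [zero_pow hk] at this
      exact this.mono_left nhdsWithin_le_nhds
    have h := hc.tendsto.comp this
    rw [eulerP_zero] at h
    exact h
  have h4 : Tendsto (fun w : ℂ => w ^ 2) (𝓝[≠] 0) (𝓝 0) := by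
    have := (continuous_pow 2 (M := ℂ)).tendsto 0
    rw [zero_pow two_ne_zero] at this
    exact this.mono_left nhdsWithin_le_nhds
  have := (h3.add ((h4.const_mul 4096).mul ((hk 4 (by norm_num)).pow 24))).div
    ((hk 2 (by norm_num)).pow 24) (by norm_num)
  simpa only [Pi.div_def, one_pow, mul_zero, zero_mul, add_zero, div_one] using this

lemma heckeNum_tendsto : Tendsto (fun z : ℍ => heckeNum z) atImInfty (𝓝 (-48)) := by
  have h := tendsto_aux.comp (Function.Periodic.qParam_tendsto (h := 2) (by norm_num))
  have h' := h.comp UpperHalfPlane.tendsto_coe_atImInfty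
  refine h'.congr fun z => ?_
  simp only [Function.comp]
  rw [heckeNum_eq (z : ℂ) _ rfl]
  have : Function.Periodic.qParam 2 (z : ℂ) = cexp (Real.pi * I * z) := by
    rw [Function.Periodic.qParam]; congr 1; push_cast; ring
  rw [this]

noncomputable def heckeForm : ModularForm 𝒮ℒ 0 :=
  have hS : (fun z : ℍ => heckeNum z) ∣[(0 : ℤ)] ModularGroup.S = (fun z : ℍ => heckeNum z) := by
    ext z
    rw [SL_slash_apply, UpperHalfPlane.modular_S_smul]
    have := heckeNum_inv z.2
    simp only [neg_zero, zpow_zero, mul_one]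
    rw [← this]
    congr 1
    rw [neg_div, one_div, inv_neg]
  have hT : (fun z : ℍ => heckeNum z) ∣[(0 : ℤ)] ModularGroup.T = (fun z : ℍ => heckeNum z) := by
    ext z
    rw [SL_slash_apply, UpperHalfPlane.modular_T_smul]
    have := heckeNum_add_one z
    simp only [neg_zero, zpow_zero, mul_one]
    rw [← this]
    congr 1
    simp [add_comm]
  { toFun := fun z : ℍ => heckeNum z
    slash_action_eq' := by
      rintro A ⟨A, rfl⟩
      exact SlashInvariantForm.slash_action_generators_SL2Z hS hT A
    holo' := by
      rw [UpperHalfPlane.mdifferentiable_iff]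
      have hd : ∀ z : ℂ, 0 < z.im → DifferentiableAt ℂ discC z := fun z hz =>
        (differentiableAt_eta_of_mem_upperHalfPlaneSet hz).pow 24
      have hh : ∀ z : ℂ, 0 < z.im → DifferentiableAt ℂ heckeNum z := by
        intro z hz
        have a1 : DifferentiableAt ℂ (fun z => discC (2 * z)) z :=
          DifferentiableAt.comp z (hd _ (im_double hz)) (by fun_prop)
        have a2 : DifferentiableAt ℂ (fun z => discC (z / 2)) z :=
          DifferentiableAt.comp z (g := discC) (f := fun z => z / 2) (hd _ (im_half hz)) (by fun_prop)
        have a3 : DifferentiableAt ℂ (fun z => discC ((z + 1) / 2)) z :=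
          DifferentiableAt.comp z (g := discC) (f := fun z => (z + 1) / 2) (hd _ (im_half (by simpa using hz))) (by fun_prop)
        exact ((((a1.const_mul 4096).add a2).add a3).div (hd z hz) (discC_ne_zero hz))
      refine .congr (fun z hz ↦ (hh z hz).differentiableWithinAt) fun z hz ↦ ?_
      simp [ofComplex_apply_of_im_pos hz]
    bdd_at_cusps' := by
      intro c hc
      rw [Subgroup.IsArithmetic.isCusp_iff_isCusp_SL2Z] at hc
      rw [OnePoint.isBoundedAt_iff_forall_SL2Z hc]
      intro γ _
      rw [SlashInvariantForm.slash_action_generators_SL2Z hS hT]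
      exact heckeNum_tendsto.isBigO_one ℝ }

lemma heckeNum_const (z : ℍ) : heckeNum z = -48 := by
  obtain ⟨c, hc⟩ := ModularFormClass.levelOne_weight_zero_const heckeForm
  have hv : ∀ z : ℍ, heckeNum z = c := fun z => congrFun hc z
  have : c = -48 := by
    refine tendsto_nhds_unique (tendsto_const_nhds (f := atImInfty)) (heckeNum_tendsto.congr hv)
  rw [hv, this]

lemma discC_prod {z : ℂ} (hz : 0 < z.im) :
    discC (2 * z) * discC (z / 2) * discC ((z + 1) / 2) = - discC z ^ 3 := by
  simp only [discC_eq]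
  obtain ⟨w, hw⟩ : ∃ w, w = cexp (Real.pi * I * z) := ⟨_, rfl⟩
  have e1 : cexp (2 * Real.pi * I * (2 * z)) = w ^ 4 := by
    rw [hw, ← Complex.exp_nat_mul]; congr 1; push_cast; ring
  have e2 : cexp (2 * Real.pi * I * (z / 2)) = w := by
    rw [hw]; congr 1; ring
  have e3 : cexp (2 * Real.pi * I * ((z + 1) / 2)) = -w := by
    rw [hw, show 2 * Real.pi * I * ((z + 1) / 2) = Real.pi * I * z + Real.pi * I by ring,
      Complex.exp_add, Complex.exp_pi_mul_I]; ring
  have e4 : cexp (2 * Real.pi * I * z) = w ^ 2 := by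
    rw [hw, ← Complex.exp_nat_mul]; congr 1; push_cast; ring
  have hn : ‖w‖ < 1 := by
    rw [hw, Complex.norm_exp, Real.exp_lt_one_iff]
    simp only [mul_re, ofReal_re, I_re, mul_zero, ofReal_im, I_im, mul_one, sub_self, zero_mul, mul_im, zero_add, add_zero, zero_sub]
    have := mul_pos Real.pi_pos hz
    linarith
  rw [e1, e2, e3, e4]
  have := congrArg (· ^ 24) (eulerP_prod hn)
  simp only [mul_pow] at this
  linear_combination (-w ^ 6) * this

lemma eta_real (t : ℝ) (ht : 0 < t) : ∃ r : ℝ, ModularForm.eta (t * I) = r := by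
  unfold ModularForm.eta
  obtain ⟨x, hx⟩ : ∃ x : ℝ, x = Real.exp (-2 * Real.pi * t) := ⟨_, rfl⟩
  have hx0 : 0 < x := by rw [hx]; exact Real.exp_pos _
  have hx1 : x < 1 := by
    rw [hx, Real.exp_lt_one_iff]
    have := mul_pos Real.pi_pos ht
    linarith
  have hm : Multipliable (fun n : ℕ => 1 + (-x ^ (n + 1))) := by
    apply multipliable_one_add_of_summable
    have := (summable_nat_add_iff 1).mpr (summable_geometric_of_lt_one hx0.le hx1)
    simpa [abs_of_pos hx0] using this
  refine ⟨Real.exp (-2 * Real.pi * t / 24) * ∏' n : ℕ, (1 + (-x ^ (n + 1))), ?_⟩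
  have h2 := hm.map_tprod Complex.ofRealHom Complex.continuous_ofReal
  rw [ofReal_mul]
  congr 1
  · rw [Function.Periodic.qParam, ofReal_exp]
    congr 1
    push_cast
    linear_combination (2 * Real.pi * t / 24 : ℂ) * I_sq
  · refine Eq.trans ?_ h2.symm
    congr 1
    ext n
    rw [ModularForm.eta_q_eq_pow]
    have : cexp (2 * Real.pi * I * (t * I)) = (x : ℂ) := by
      rw [hx, ofReal_exp]
      congr 1
      push_cast
      linear_combination (2 * Real.pi * t : ℂ) * I_sq
    rw [this]
    simp [sub_eq_add_neg]

lemma lambda_aux : 16 * ModularForm.eta (I / 2) ^ 8 * ModularForm.eta (2 * I) ^ 16 / ModularForm.eta I ^ 24 = 1 / 2 := by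
  have hI : 0 < I.im := by simp
  have h2 : 0 < (2 * I).im := by simp
  have e8 : ModularForm.eta (I / 2) ^ 8 = 16 * ModularForm.eta (2 * I) ^ 8 := by
    have := eta_inv_pow8 h2
    rw [show -1 / (2 * I) = I / 2 by field_simp; simp] at this
    rw [this, mul_pow, I_pow_four]; norm_num
  have eD : discC (I / 2) = 4096 * discC (2 * I) := by
    unfold discC
    rw [show 24 = 8 * 3 from rfl, pow_mul, e8]; ring
  have hp := discC_prod hI
  have hk := heckeNum_const UpperHalfPlane.I
  unfold heckeNum at hk
  rw [UpperHalfPlane.coe_I] at hk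
  have hD := discC_ne_zero hI
  rw [div_eq_iff hD] at hk
  rw [eD] at hp hk
  have hgoal : 512 * discC (2 * I) = discC I := by
    have cub : (512 * discC (2 * I) - discC I) * (256 * discC (2 * I) + discC I) ^ 2 = 0 := by
      linear_combination (4096 * discC (2 * I) ^ 2) * hk - hp
    rcases mul_eq_zero.mp cub with h | h
    · linear_combination h
    · exfalso
      have h := pow_eq_zero_iff (two_ne_zero) |>.mp h
      obtain ⟨r, hr⟩ := eta_real 1 one_pos
      obtain ⟨s, hs⟩ := eta_real 2 two_pos
      simp only [ofReal_one, one_mul, ofReal_ofNat] at hr hs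
      unfold discC at h hD
      rw [hr, hs] at h
      rw [hr] at hD
      norm_cast at h hD
      have : 0 < r ^ 24 := lt_of_le_of_ne (by positivity) (Ne.symm hD)
      have : 0 ≤ s ^ 24 := by positivity
      linarith
  rw [e8]
  rw [show 16 * (16 * ModularForm.eta (2 * I) ^ 8) * ModularForm.eta (2 * I) ^ 16 = 256 * discC (2 * I) by unfold discC; ring]
  change 256 * discC (2 * I) / discC I = 1 / 2
  rw [div_eq_iff hD]
  linear_combination (1/2) * hgoal

end

section
open Complex
open MeasureTheory
noncomputable def binC (n : ℕ) : ℂ := Polynomial.eval (1/3 : ℂ) (ascPochhammer ℂ n) / n.factorial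

lemma choose_eq_binC (n : ℕ) : Ring.choose ((1/3 : ℂ) + n - 1) n = binC n := by
  have h := Ring.factorial_nsmul_multichoose_eq_ascPochhammer (1/3 : ℂ) n
  rw [Polynomial.ascPochhammer_smeval_eq_eval, nsmul_eq_mul] at h
  have h2 : (n.factorial : ℂ) ≠ 0 := by exact_mod_cast n.factorial_ne_zero
  rw [binC, ← h, Ring.multichoose_eq, mul_div_cancel_left₀ _ h2]

lemma binC_hasSum {x : ℂ} (hx : ‖x‖ < 1) :
    HasSum (fun n => binC n * x ^ n) ((1 - x) ^ (-(1/3) : ℂ)) := by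
  have h := one_div_one_sub_cpow_hasFPowerSeriesOnBall_zero (1/3)
  have := h.hasSum (y := x) (by simpa [← ofReal_norm] using hx)
  simp only [choose_eq_binC] at this
  rw [cpow_neg, ← one_div]
  simpa [FormalMultilinearSeries.ofScalars_apply_eq, mul_comm] using this

lemma binC_summable : Summable (fun n => ‖binC n‖ * (1/2 : ℝ) ^ n) := by
  have := (binC_hasSum (x := 1/2) (by norm_num)).summable.norm
  refine this.congr fun n => ?_
  simp

lemma poch_ratio (n : ℕ) : Polynomial.eval (5/3 : ℂ) (ascPochhammer ℂ n) * (2/3) =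
    Polynomial.eval (2/3 : ℂ) (ascPochhammer ℂ n) * (2/3 + n) := by
  induction n with
  | zero => simp
  | succ n ih =>
    rw [ascPochhammer_succ_eval, ascPochhammer_succ_eval]
    push_cast
    linear_combination (5/3 + (n : ℂ)) * ih

lemma poch_ne_zero (n : ℕ) : Polynomial.eval (5/3 : ℂ) (ascPochhammer ℂ n) ≠ 0 := by
  induction n with
  | zero => simp
  | succ n ih =>
    rw [ascPochhammer_succ_eval]
    refine mul_ne_zero ih fun h => ?_
    have h2 := congrArg Complex.re h
    norm_num at h2
    have : (0:ℝ) ≤ n := by positivity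
    linarith

lemma half_integral : ∫ u in (0:ℝ)..(1/2), (u : ℂ) ^ ((2/3 : ℂ) - 1) * (1 - (u : ℂ)) ^ ((2/3 : ℂ) - 1) =
    (3/2) * ((1 / 2 : ℂ) ^ (2/3 : ℂ) * hyperGeom (1/3) (2/3) (5/3) (1/2)) := by
  have h := intervalIntegral.hasSum_integral_of_dominated_convergence (μ := volume) (a := 0) (b := 1/2)
    (F := fun n (u : ℝ) => binC n * (u : ℂ) ^ n * (u : ℂ) ^ ((2/3 : ℂ) - 1))
    (f := fun u : ℝ => (u : ℂ) ^ ((2/3 : ℂ) - 1) * (1 - (u : ℂ)) ^ ((2/3 : ℂ) - 1))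
    (fun n u => ‖binC n‖ * (1/2 : ℝ) ^ n * u ^ (-(1/3) : ℝ))
    (by
      intro n
      apply Measurable.aestronglyMeasurable
      fun_prop)
    (by
      intro n
      refine Filter.Eventually.of_forall fun u hu => ?_
      rw [Set.uIoc_of_le (by norm_num)] at hu
      rw [norm_mul, norm_mul, norm_pow, norm_real, Real.norm_of_nonneg hu.1.le,
        Complex.norm_cpow_eq_rpow_re_of_pos hu.1]
      have : ((2/3 : ℂ) - 1).re = -(1/3) := by norm_num
      rw [this]
      have := hu.2
      have := hu.1
      gcongr)
    (by
      refine Filter.Eventually.of_forall fun u hu => ?_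
      exact binC_summable.mul_right _)
    (by
      simp only [tsum_mul_right]
      apply IntervalIntegrable.const_mul
      exact intervalIntegral.intervalIntegrable_rpow' (by norm_num))
    (by
      refine Filter.Eventually.of_forall fun u hu => ?_
      rw [Set.uIoc_of_le (by norm_num)] at hu
      have := (binC_hasSum (x := (u : ℂ)) (by
        rw [norm_real, Real.norm_of_nonneg hu.1.le]; linarith [hu.2])).mul_right ((u : ℂ) ^ ((2/3 : ℂ) - 1))
      rw [show (2/3 : ℂ) - 1 = -(1/3) by norm_num] at this ⊢
      rw [mul_comm]
      exact this)
  have hterm : ∀ n : ℕ, ∫ u in (0:ℝ)..(1/2), binC n * (u : ℂ) ^ n * (u : ℂ) ^ ((2/3 : ℂ) - 1) =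
      (3/2) * ((1 / 2 : ℂ) ^ (2/3 : ℂ) * ((Polynomial.eval (1/3) (ascPochhammer ℂ n) * Polynomial.eval (2/3) (ascPochhammer ℂ n) /
      (Polynomial.eval (5/3) (ascPochhammer ℂ n) * (n.factorial : ℂ))) * (1/2) ^ n)) := by
    intro n
    have hne : (2/3 : ℂ) + n ≠ 0 := by
      intro h
      have h2 := congrArg Complex.re h
      norm_num at h2
      have : (0:ℝ) ≤ n := by positivity
      linarith
    have e1 : ∫ u in (0:ℝ)..(1/2), binC n * (u : ℂ) ^ n * (u : ℂ) ^ ((2/3 : ℂ) - 1) =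
        ∫ u in (0:ℝ)..(1/2), binC n * (u : ℂ) ^ ((n : ℂ) + ((2/3 : ℂ) - 1)) := by
      apply intervalIntegral.integral_congr_ae
      refine Filter.Eventually.of_forall fun u hu => ?_
      rw [Set.uIoc_of_le (by norm_num)] at hu
      have : (u : ℂ) ≠ 0 := by exact_mod_cast hu.1.ne'
      rw [Complex.cpow_add _ _ this, Complex.cpow_natCast, mul_assoc]
    rw [e1, intervalIntegral.integral_const_mul, integral_cpow (by left; simp; have : (0:ℝ) ≤ n := by positivity
                                                                   linarith)]
    rw [show (n : ℂ) + ((2/3 : ℂ) - 1) + 1 = 2/3 + n by ring]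
    rw [ofReal_zero, Complex.zero_cpow hne, sub_zero]
    push_cast
    rw [Complex.cpow_add _ _ (by norm_num), Complex.cpow_natCast, binC]
    have hr := poch_ratio n
    have h5 := poch_ne_zero n
    have hf : (n.factorial : ℂ) ≠ 0 := by exact_mod_cast n.factorial_ne_zero
    have key : ((2/3 : ℂ) + n)⁻¹ = 3/2 * (Polynomial.eval (2/3 : ℂ) (ascPochhammer ℂ n) *
        (Polynomial.eval (5/3 : ℂ) (ascPochhammer ℂ n))⁻¹) := by
      apply inv_eq_of_mul_eq_one_right
      generalize Polynomial.eval (2/3 : ℂ) (ascPochhammer ℂ n) = p at *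
      generalize Polynomial.eval (5/3 : ℂ) (ascPochhammer ℂ n) = r at *
      have h1 : r * r⁻¹ = 1 := mul_inv_cancel₀ h5
      linear_combination h1 - (3/2) * r⁻¹ * hr
    rw [div_eq_mul_inv _ ((2/3 : ℂ) + n), key]
    generalize Polynomial.eval (1/3 : ℂ) (ascPochhammer ℂ n) = s
    generalize Polynomial.eval (2/3 : ℂ) (ascPochhammer ℂ n) = p
    generalize Polynomial.eval (5/3 : ℂ) (ascPochhammer ℂ n) = r
    generalize ((1/2 : ℂ)) ^ ((2/3 : ℂ)) = w
    rw [div_eq_mul_inv (s * p), mul_inv]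
    ring
  rw [← h.tsum_eq]
  simp only [hterm]
  rw [tsum_mul_left, tsum_mul_left]
  rfl

lemma beta_half : betaIntegral (2/3) (2/3) =
    2 * ∫ u in (0:ℝ)..(1/2), (u : ℂ) ^ ((2/3 : ℂ) - 1) * (1 - (u : ℂ)) ^ ((2/3 : ℂ) - 1) := by
  have hi : IntervalIntegrable (fun u : ℝ => (u : ℂ) ^ ((2/3 : ℂ) - 1) * (1 - (u : ℂ)) ^ ((2/3 : ℂ) - 1)) volume 0 1 :=
    betaIntegral_convergent (by norm_num) (by norm_num)
  have hs := intervalIntegral.integral_comp_sub_left (a := 0) (b := 1/2)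
    (fun u : ℝ => (u : ℂ) ^ ((2/3 : ℂ) - 1) * (1 - (u : ℂ)) ^ ((2/3 : ℂ) - 1)) 1
  rw [betaIntegral, ← intervalIntegral.integral_add_adjacent_intervals (b := 1/2)
    (hi.mono_set (by rw [Set.uIcc_of_le, Set.uIcc_of_le] <;> first | exact Set.Icc_subset_Icc (by norm_num) (by norm_num) | norm_num))
    (hi.mono_set (by rw [Set.uIcc_of_le, Set.uIcc_of_le] <;> first | exact Set.Icc_subset_Icc (by norm_num) (by norm_num) | norm_num))]
  norm_num at hs ⊢
  rw [← hs, two_mul]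
  congr 1
  apply intervalIntegral.integral_congr
  intro u _
  simp [mul_comm]

lemma beta_value : betaIntegral (2/3) (2/3) = 4 * Real.pi ^ 2 / Complex.Gamma (1/3) ^ 3 := by
  have h1 := Gamma_mul_Gamma_eq_betaIntegral (s := 2/3) (t := 2/3) (by norm_num) (by norm_num)
  have h2 := Complex.Gamma_mul_Gamma_one_sub (1/3)
  have h3 := Complex.Gamma_add_one (1/3) (by norm_num)
  have hs : Complex.sin (Real.pi * (1/3)) = (Real.sqrt 3 / 2 : ℝ) := by
    rw [← Real.sin_pi_div_three]; push_cast; congr 1; ring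
  have hG : Complex.Gamma (1/3) ≠ 0 := Complex.Gamma_ne_zero_of_re_pos (by norm_num)
  have hq : ((Real.sqrt 3 : ℝ) : ℂ) ^ 2 = 3 := by
    rw [← ofReal_pow, Real.sq_sqrt (by norm_num)]; norm_num
  have hq0 : ((Real.sqrt 3 : ℝ) : ℂ) ≠ 0 := by
    intro h; rw [h] at hq; norm_num at hq
  rw [show (2/3 : ℂ) + 2/3 = 1/3 + 1 by norm_num, h3] at h1
  rw [show (1 : ℂ) - 1/3 = 2/3 by norm_num, hs] at h2
  push_cast at h2
  have h4 : Complex.Gamma (2/3) = 2 * Real.pi / (Real.sqrt 3 * Complex.Gamma (1/3)) := by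
    field_simp at h2 ⊢
    linear_combination h2
  rw [h4] at h1
  field_simp at h1 ⊢
  rw [hq] at h1
  linear_combination (-1/3) * h1

lemma second_part : (2 : ℂ) ^ (-(8 : ℂ) / 3) * ((1 : ℂ) / 2) ^ ((2 : ℂ) / 3) *
          hyperGeom (1 / 3) (2 / 3) (5 / 3) (1 / 2) =
        (2 : ℂ) ^ ((1 : ℂ) / 3) * (Real.pi : ℂ) ^ 2 / (6 * Complex.Gamma (1 / 3) ^ 3) := by
  have hb := beta_half
  rw [half_integral, beta_value] at hb
  have hc : (2 : ℂ) ^ (-(8 : ℂ) / 3) = (2 : ℂ) ^ ((1 : ℂ) / 3) / 8 := by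
    rw [show -(8 : ℂ) / 3 = 1 / 3 - (3 : ℕ) by push_cast; norm_num, Complex.cpow_sub _ _ two_ne_zero, Complex.cpow_natCast]
    norm_num
  have hG : Complex.Gamma (1/3) ≠ 0 := Complex.Gamma_ne_zero_of_re_pos (by norm_num)
  rw [hc, mul_assoc]
  have : ((1 : ℂ) / 2) ^ ((2 : ℂ) / 3) * hyperGeom (1 / 3) (2 / 3) (5 / 3) (1 / 2) =
      (1/3) * (4 * Real.pi ^ 2 / Complex.Gamma (1/3) ^ 3) := by
    linear_combination (-1/3) * hb
  rw [this]
  field_simp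
  norm_num

end

lemma dedekindEta_eq (z : ℂ) : dedekindEta z = ModularForm.eta z := by
  unfold dedekindEta ModularForm.eta
  simp only [ModularForm.eta_q_eq_cexp, Function.Periodic.qParam]
  congr 2
  push_cast
  ring

/-- `φ(i) = C/2` with `C = 2^{1/3} π² / (3 Γ(1/3)³)`: using `λ(i) = 1/2`, this is the
evaluation `2^{-8/3} (1/2)^{2/3} ₂F₁(1/3, 2/3; 5/3; 1/2) = 2^{1/3} π² / (6 Γ(1/3)³)`. -/
theorem phi_at_i :
    modularLambda I = 1 / 2 ∧
      (2 : ℂ) ^ (-(8 : ℂ) / 3) * ((1 : ℂ) / 2) ^ ((2 : ℂ) / 3) *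
          hyperGeom (1 / 3) (2 / 3) (5 / 3) (1 / 2) =
        (2 : ℂ) ^ ((1 : ℂ) / 3) * (Real.pi : ℂ) ^ 2 / (6 * Complex.Gamma (1 / 3) ^ 3) := by
  refine ⟨?_, second_part⟩
  unfold modularLambda
  rw [dedekindEta_eq, dedekindEta_eq, dedekindEta_eq]
  exact lambda_aux
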